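/- arXiv:2301.01672 — 2 statements merged into one kernel-verified Lean document; each statement's English description precedes it below -/
import Mathlib

section
/- Let ψ : ℝ → ℂ be a bounded measurable function with ψ(t) = 0 for all t < 0, and let ℒψ(s) = ∫_0^∞ ψ(t) e^{−st} dt for Re s > 0 be its Laplace transform. Suppose ℒψ has H¹ boundary behavior at s = 0: there exist δ > 0 and F ∈ L^1((−δ, δ)) such that ∫_{−δ}^{δ} |ℒψ(x + iy) − F(y)| dy → 0 as x → 0⁺. Then ψ is almost convergent to 0, i.e., lim_{θ→∞} (1/(2θ)) ∫_{x−θ}^{x+θ} ψ(t) dt = 0 uniformly in x ∈ ℝ. -/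
open MeasureTheory Filter

open scoped FourierTransform SchwartzMap in
lemma exists_kernel (δ : ℝ) (hδ : 0 < δ) : ∃ φ K : ℝ → ℂ, Continuous φ ∧ (∃ B : ℝ, ∀ y, ‖φ y‖ ≤ B) ∧
    Integrable φ ∧ (∀ y, y ∉ Set.Ioo (-δ) δ → φ y = 0) ∧
    (∀ t : ℝ, K t = ∫ y : ℝ, φ y * Complex.exp (-(Complex.I * y * t))) ∧
    Continuous K ∧ Integrable K ∧ Integrable (fun t => |t| * ‖K t‖) ∧ ∫ t, K t ≠ 0 := by
  let b : ContDiffBump (0 : ℝ) := ⟨δ / 2, δ, by positivity, by linarith⟩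
  have hb1 : HasCompactSupport (fun y => ((b y : ℝ) : ℂ)) :=
    b.hasCompactSupport.comp_left (g := fun x : ℝ => (x : ℂ)) (by simp)
  have hb2 : ContDiff ℝ ((⊤ : ℕ∞) : WithTop ℕ∞) (fun y => ((b y : ℝ) : ℂ)) :=
    Complex.ofRealCLM.contDiff.comp b.contDiff
  let φ : 𝓢(ℝ, ℂ) := hb1.toSchwartzMap hb2
  have hφ : ∀ y, φ y = ((b y : ℝ) : ℂ) := fun y => rfl
  let H : 𝓢(ℝ, ℂ) := 𝓕 φ
  have hpi : (2 * Real.pi) ≠ 0 := by positivity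
  have hpi' : (0:ℝ) < 2 * Real.pi := by positivity
  refine ⟨φ, fun t => H (t / (2 * Real.pi)), φ.continuous, ⟨1, fun y => ?_⟩, φ.integrable, ?_, ?_, ?_, ?_, ?_, ?_⟩
  · rw [hφ, Complex.norm_real, Real.norm_of_nonneg b.nonneg]; exact b.le_one
  · intro y hy
    rw [hφ, b.zero_of_le_dist, Complex.ofReal_zero]
    simp only [Real.dist_eq, sub_zero]
    by_contra h
    push Not at h
    exact hy (abs_lt.mp h)
  · intro t
    change 𝓕 φ (t / (2 * Real.pi)) = _
    rw [SchwartzMap.fourier_coe, Real.fourier_real_eq_integral_exp_smul]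
    congr 1; ext y
    rw [smul_eq_mul, mul_comm]
    congr 2
    push_cast
    have : (Real.pi : ℂ) ≠ 0 := by exact_mod_cast Real.pi_ne_zero
    field_simp
  · exact H.continuous.comp (by fun_prop)
  · exact H.integrable.comp_div hpi
  · have := ((H.integrable_pow_mul volume 1).comp_div hpi).const_mul (2 * Real.pi)
    refine this.congr (Eventually.of_forall fun t => ?_)
    simp only [pow_one, Real.norm_eq_abs, abs_div, abs_of_pos hpi']
    field_simp
  · rw [Measure.integral_comp_div (fun t => H t)]
    have h0 : ∫ t, H t = 1 := by
      have h1 : 𝓕⁻ H = φ := FourierTransform.fourierInv_fourier_eq φ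
      have h2 : (𝓕⁻ H) 0 = φ 0 := by rw [h1]
      rw [SchwartzMap.fourierInv_coe, Real.fourierInv_eq] at h2
      rw [hφ, b.one_of_mem_closedBall (by simpa using b.rIn_pos.le)] at h2
      simpa using h2
    rw [h0]
    simp [Real.pi_ne_zero]

lemma laplace_kernel (ψ : ℝ → ℂ) (hmeas : Measurable ψ) (C : ℝ) (hC : ∀ x, ‖ψ x‖ ≤ C)
    (S : Set ℝ)
    (φ K : ℝ → ℂ) (hφc : Continuous φ) (hφi : Integrable φ) (hφS : ∀ y, y ∉ S → φ y = 0)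
    (hK : ∀ t : ℝ, K t = ∫ y : ℝ, φ y * Complex.exp (-(Complex.I * y * t)))
    (σ : ℝ) (hσ : 0 < σ) (x : ℝ) :
    ∫ t in Set.Ioi (0:ℝ), K (t - x) * (ψ t * Complex.exp (-(σ * t))) =
      ∫ y in S, (φ y * Complex.exp (Complex.I * x * y)) *
        ∫ t in Set.Ioi (0 : ℝ), ψ t * Complex.exp (-((σ + Complex.I * y) * t)) := by
  have hS' : ∀ g : ℝ → ℂ, ∫ y in S, φ y * g y = ∫ y, φ y * g y := by
    intro g
    apply setIntegral_eq_integral_of_forall_compl_eq_zero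
    intro y hy; simp [hφS y hy]
  simp_rw [mul_assoc (φ _)]
  rw [hS']
  simp_rw [hK, ← integral_const_mul, ← integral_mul_const]
  rw [integral_integral_swap]
  · congr 1; ext y
    congr 1; ext t
    rw [mul_assoc]
    congr 1
    rw [mul_left_comm, mul_left_comm _ (ψ t), ← Complex.exp_add, ← Complex.exp_add]
    congr 2; push_cast; ring
  · have hψ : Integrable (fun t => ψ t * Complex.exp (-(σ * t))) (volume.restrict (Set.Ioi (0:ℝ))) := by
      refine Integrable.mono' ((integrableOn_exp_mul_Ioi (a := -σ) (by linarith) 0).const_mul C) (by fun_prop) ?_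
      refine Eventually.of_forall fun t => ?_
      rw [norm_mul, Complex.norm_exp]
      have : (-((σ:ℂ) * t)).re = -σ * t := by simp
      rw [this]
      exact mul_le_mul_of_nonneg_right (hC t) (Real.exp_pos _).le
    refine (hψ.mul_prod hφi).mono (by fun_prop) ?_
    refine Eventually.of_forall fun p => ?_
    have : ‖Complex.exp (-(Complex.I * p.2 * ((p.1 - x : ℝ) : ℂ)))‖ = 1 := by
      rw [Complex.norm_exp]; simp
    simp only [Function.uncurry, norm_mul, this, mul_one]
    exact le_of_eq (mul_comm _ _)

lemma kernel_conv_tendsto (ψ : ℝ → ℂ) (hmeas : Measurable ψ) (C : ℝ) (hC : ∀ x, ‖ψ x‖ ≤ C)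
    (hneg : ∀ t : ℝ, t < 0 → ψ t = 0)
    (δ : ℝ) (F : ℝ → ℂ)
    (hF : IntegrableOn F (Set.Ioo (-δ) δ) volume)
    (hH1 : Tendsto (fun x : ℝ =>
        ∫ y in Set.Ioo (-δ) δ,
          ‖(∫ t in Set.Ioi (0 : ℝ),
              ψ t * Complex.exp (-((x + Complex.I * y) * t))) - F y‖)
      (nhdsWithin 0 (Set.Ioi 0)) (nhds 0))
    (φ K : ℝ → ℂ) (hφc : Continuous φ) (B : ℝ) (hB : ∀ y, ‖φ y‖ ≤ B)
    (hφi : Integrable φ) (hφS : ∀ y, y ∉ Set.Ioo (-δ) δ → φ y = 0)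
    (hK : ∀ t : ℝ, K t = ∫ y : ℝ, φ y * Complex.exp (-(Complex.I * y * t)))
    (hKc : Continuous K) (hKi : Integrable K) :
    Tendsto (fun x : ℝ => ∫ u, K u * ψ (x + u)) (cocompact ℝ) (nhds 0) := by
  set S := Set.Ioo (-δ) δ with hSdef
  let L : ℝ → ℝ → ℂ := fun σ y => ∫ t in Set.Ioi (0 : ℝ), ψ t * Complex.exp (-((σ + Complex.I * y) * t))
  have hFint : ∀ g : ℝ → ℂ, Continuous g → (∀ y, ‖g y‖ ≤ B) → IntegrableOn (fun y => g y * F y) S := by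
    intro g hg hgB
    exact hF.bdd_mul hg.aestronglyMeasurable (Eventually.of_forall hgB)
  have hLnorm : ∀ σ : ℝ, 0 < σ → ∀ y, ‖L σ y‖ ≤ C * (1 / σ) := by
    intro σ hσ y
    have h1 : ∫ t in Set.Ioi (0:ℝ), C * Real.exp (-σ * t) = C * (1 / σ) := by
      rw [integral_const_mul, integral_exp_mul_Ioi (by linarith) 0]
      simp [neg_div_neg_eq]
    rw [← h1]
    refine norm_integral_le_of_norm_le ((integrableOn_exp_mul_Ioi (a := -σ) (by linarith) 0).const_mul C) ?_
    refine Eventually.of_forall fun t => ?_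
    rw [norm_mul, Complex.norm_exp]
    have : (-((σ + Complex.I * y) * t)).re = -σ * t := by simp
    rw [this]
    exact mul_le_mul_of_nonneg_right (hC t) (Real.exp_pos _).le
  have hLmeas : ∀ σ : ℝ, AEStronglyMeasurable (L σ) (volume.restrict S) := by
    intro σ
    have : StronglyMeasurable (Function.uncurry fun (y t : ℝ) => ψ t * Complex.exp (-((σ + Complex.I * y) * t))) := by
      apply Measurable.stronglyMeasurable
      unfold Function.uncurry
      fun_prop
    exact (this.integral_prod_right (ν := volume.restrict (Set.Ioi (0:ℝ)))).aestronglyMeasurable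
  have hLint : ∀ σ : ℝ, 0 < σ → IntegrableOn (L σ) S := by
    intro σ hσ
    refine Integrable.mono' (g := fun _ => C * (1/σ)) ?_ (hLmeas σ) (Eventually.of_forall (hLnorm σ hσ))
    exact integrableOn_const (by simp [hSdef])
  have key : ∀ x : ℝ, ∫ u, K u * ψ (x + u) = ∫ y in S, (φ y * Complex.exp (Complex.I * x * y)) * F y := by
    intro x
    have e1 : ∫ u, K u * ψ (x + u) = ∫ t in Set.Ioi (0:ℝ), K (t - x) * ψ t := by
      rw [← integral_sub_right_eq_self (fun u => K u * ψ (x + u)) x, ← integral_Ici_eq_integral_Ioi,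
        setIntegral_eq_integral_of_forall_compl_eq_zero]
      · simp
      · intro t ht
        rw [hneg t (by simpa using ht), mul_zero]
    rw [e1]
    have hg : Continuous fun y : ℝ => φ y * Complex.exp (Complex.I * x * y) := by fun_prop
    have hgn : ∀ y : ℝ, ‖φ y * Complex.exp (Complex.I * x * y)‖ ≤ B := by
      intro y
      have : ‖Complex.exp (Complex.I * x * y)‖ = 1 := by
        rw [Complex.norm_exp]; simp
      rw [norm_mul, this, mul_one]; exact hB y
    have hKx : Integrable (fun t => K (t - x)) := hKi.comp_sub_right x
    have l1 : Tendsto (fun σ : ℝ => ∫ t in Set.Ioi (0:ℝ), K (t - x) * (ψ t * Complex.exp (-(σ * t))))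
        (nhdsWithin 0 (Set.Ioi 0)) (nhds (∫ t in Set.Ioi (0:ℝ), K (t - x) * ψ t)) := by
      refine tendsto_integral_filter_of_dominated_convergence (fun t => ‖K (t - x)‖ * C) ?_ ?_ ?_ ?_
      · exact Eventually.of_forall fun σ => by fun_prop
      · filter_upwards [self_mem_nhdsWithin] with σ hσ
        refine (ae_restrict_iff' measurableSet_Ioi).2 (Eventually.of_forall fun t ht => ?_)
        rw [norm_mul, norm_mul]
        refine mul_le_mul_of_nonneg_left ?_ (norm_nonneg _)
        refine le_trans (mul_le_of_le_one_right (norm_nonneg _) ?_) (hC t)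
        rw [Complex.norm_exp]
        have : (-((σ:ℂ) * t)).re = -(σ * t) := by simp
        rw [this, Real.exp_le_one_iff]
        have := mul_pos (Set.mem_Ioi.1 hσ) (Set.mem_Ioi.1 ht)
        linarith
      · exact (hKx.norm.mul_const C).integrableOn
      · refine Eventually.of_forall fun t => ?_
        have : Continuous fun σ : ℝ => K (t - x) * (ψ t * Complex.exp (-(σ * t))) := by fun_prop
        have h := this.tendsto 0
        simp only [Complex.ofReal_zero, zero_mul, neg_zero, Complex.exp_zero, mul_one] at h
        exact h.mono_left nhdsWithin_le_nhds
    have l2 : Tendsto (fun σ : ℝ => ∫ t in Set.Ioi (0:ℝ), K (t - x) * (ψ t * Complex.exp (-(σ * t))))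
        (nhdsWithin 0 (Set.Ioi 0)) (nhds (∫ y in S, (φ y * Complex.exp (Complex.I * x * y)) * F y)) := by
      rw [tendsto_iff_norm_sub_tendsto_zero]
      have hH2 := hH1.const_mul B
      rw [mul_zero] at hH2
      refine tendsto_of_tendsto_of_tendsto_of_le_of_le' tendsto_const_nhds hH2
        (Eventually.of_forall fun σ => norm_nonneg _) ?_
      filter_upwards [self_mem_nhdsWithin] with σ hσ
      have hσ : 0 < σ := hσ
      rw [laplace_kernel ψ hmeas C hC S φ K hφc hφi hφS hK σ hσ x,
        ← integral_sub ((hLint σ hσ).bdd_mul hg.aestronglyMeasurable (Eventually.of_forall hgn)) (hFint _ hg hgn),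
        ← integral_const_mul]
      refine norm_integral_le_of_norm_le (((hLint σ hσ).sub hF).norm.const_mul B) ?_
      refine Eventually.of_forall fun y => ?_
      simp only [← mul_sub]
      rw [norm_mul]
      exact mul_le_mul_of_nonneg_right (hgn y) (norm_nonneg _)
    exact tendsto_nhds_unique l1 l2
  have RL := Real.tendsto_integral_exp_smul_cocompact (fun y => S.indicator (fun y => φ y * F y) y)
  have hm : Tendsto (fun x : ℝ => x * (-(1 / (2 * Real.pi)))) (cocompact ℝ) (cocompact ℝ) :=
    (Homeomorph.mulRight₀ (-(1 / (2 * Real.pi))) (by simp [Real.pi_ne_zero])).isClosedEmbedding.tendsto_cocompact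
  refine (RL.comp hm).congr fun x => ?_
  rw [key, ← integral_indicator measurableSet_Ioo]
  simp only [Function.comp]
  congr 1; ext y
  by_cases hy : y ∈ S
  · rw [Set.indicator_of_mem hy, Set.indicator_of_mem hy, Circle.smul_def, Real.fourierChar_apply, smul_eq_mul,
      mul_right_comm (φ y), mul_comm]
    congr 1
    congr 1
    push_cast
    have : (Real.pi : ℂ) ≠ 0 := by exact_mod_cast Real.pi_ne_zero
    field_simp
  · rw [Set.indicator_of_notMem hy, Set.indicator_of_notMem hy, smul_zero]

lemma window_shift (ψ : ℝ → ℂ) (C : ℝ) (hC : ∀ x, ‖ψ x‖ ≤ C)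
    (hint : ∀ a b : ℝ, IntervalIntegrable ψ volume a b) (x θ u : ℝ) :
    ‖(∫ t in (x - θ)..(x + θ), ψ t) - ∫ t in (x + u - θ)..(x + u + θ), ψ t‖ ≤ 2 * C * |u| := by
  have h : (∫ t in (x - θ)..(x + θ), ψ t) - ∫ t in (x + u - θ)..(x + u + θ), ψ t
      = (∫ t in (x - θ)..(x + u - θ), ψ t) - ∫ t in (x + θ)..(x + u + θ), ψ t := by
    exact intervalIntegral.integral_interval_sub_interval_comm (hint _ _) (hint _ _) (hint _ _)
  rw [h]
  have h1 := intervalIntegral.norm_integral_le_of_norm_le_const (a := x - θ) (b := x + u - θ) (f := ψ) (C := C)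
    (fun t _ => hC t)
  have h2 := intervalIntegral.norm_integral_le_of_norm_le_const (a := x + θ) (b := x + u + θ) (f := ψ) (C := C)
    (fun t _ => hC t)
  rw [show x + u - θ - (x - θ) = u by ring] at h1
  rw [show x + u + θ - (x + θ) = u by ring] at h2
  refine (norm_sub_le _ _).trans ?_
  linarith

lemma window_conv (ψ : ℝ → ℂ) (hmeas : Measurable ψ) (C : ℝ) (hC : ∀ x, ‖ψ x‖ ≤ C)
    (K : ℝ → ℂ) (hKc : Continuous K) (hKi : Integrable K) (hK1 : Integrable (fun t => |t| * ‖K t‖))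
    (x θ : ℝ) (hθ : 0 ≤ θ) :
    ‖(∫ t, K t) * (∫ t in (x - θ)..(x + θ), ψ t)‖ ≤
      2 * C * (∫ t, |t| * ‖K t‖) + ‖∫ s in (x - θ)..(x + θ), ∫ u, K u * ψ (s + u)‖ := by
  have hint : ∀ a b : ℝ, IntervalIntegrable ψ volume a b := fun a b =>
    (intervalIntegrable_const (c := C)).mono_fun' hmeas.aestronglyMeasurable (Eventually.of_forall hC)
  have hle : x - θ ≤ x + θ := by linarith
  have hprod : Integrable (Function.uncurry fun s u => K u * ψ (s + u))
      ((volume.restrict (Set.Ioc (x - θ) (x + θ))).prod volume) := by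
    have hc : Integrable (fun _ : ℝ => C) (volume.restrict (Set.Ioc (x - θ) (x + θ))) :=
      integrableOn_const (by simp)
    refine (hc.mul_prod hKi.norm).mono' ?_ ?_
    · have := hKc.measurable
      apply Measurable.aestronglyMeasurable
      unfold Function.uncurry
      fun_prop
    · refine Eventually.of_forall fun p => ?_
      simp only [Function.uncurry, norm_mul]
      rw [mul_comm]
      exact mul_le_mul_of_nonneg_right (hC _) (norm_nonneg _)
  have hin : ∀ u, ∫ s in Set.Ioc (x - θ) (x + θ), K u * ψ (s + u) =
      K u * ∫ t in (x + u - θ)..(x + u + θ), ψ t := by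
    intro u
    rw [integral_const_mul, ← intervalIntegral.integral_of_le hle,
      intervalIntegral.integral_comp_add_right (fun s => ψ s)]
    congr 2 <;> ring
  have hsw : ∫ s in (x - θ)..(x + θ), ∫ u, K u * ψ (s + u) =
      ∫ u, K u * ∫ t in (x + u - θ)..(x + u + θ), ψ t := by
    rw [intervalIntegral.integral_of_le hle, integral_integral_swap hprod]
    simp_rw [hin]
  have hi2 : Integrable fun u => K u * ∫ t in (x + u - θ)..(x + u + θ), ψ t := by
    have := hprod.integral_prod_right
    simpa only [Function.uncurry, hin] using this
  have hdiff : (∫ t, K t) * (∫ t in (x - θ)..(x + θ), ψ t) =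
      (∫ u, K u * ((∫ t in (x - θ)..(x + θ), ψ t) - ∫ t in (x + u - θ)..(x + u + θ), ψ t))
      + ∫ s in (x - θ)..(x + θ), ∫ u, K u * ψ (s + u) := by
    rw [hsw, ← integral_mul_const]
    simp_rw [mul_sub]
    rw [integral_sub (hKi.mul_const _) hi2]
    ring
  rw [hdiff]
  refine (norm_add_le _ _).trans (add_le_add_left ?_ _)
  rw [← integral_const_mul]
  refine norm_integral_le_of_norm_le (hK1.const_mul _) (Eventually.of_forall fun u => ?_)
  rw [norm_mul]
  have := mul_le_mul_of_nonneg_left (window_shift ψ C hC hint x θ u) (norm_nonneg (K u))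
  linarith

lemma window_bound (G : ℝ → ℂ) (M R ε : ℝ) (hM : 0 ≤ M) (hR : 0 ≤ R) (hε : 0 ≤ ε)
    (hGM : ∀ x, ‖G x‖ ≤ M)
    (hGR : ∀ x, R < |x| → ‖G x‖ ≤ ε) (x θ : ℝ) (hθ : 0 ≤ θ) :
    ‖∫ s in (x - θ)..(x + θ), G s‖ ≤ 2 * R * M + 2 * θ * ε := by
  have hle : x - θ ≤ x + θ := by linarith
  rw [intervalIntegral.integral_of_le hle]
  let h : ℝ → ℝ := (Set.Icc (-R) R).indicator (fun _ => M)
  have hi : Integrable h := by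
    rw [integrable_indicator_iff measurableSet_Icc]
    exact integrableOn_const (by simp)
  have hh0 : ∀ s, 0 ≤ h s := fun s => Set.indicator_nonneg (fun _ _ => hM) s
  have hc : IntegrableOn (fun _ : ℝ => ε) (Set.Ioc (x - θ) (x + θ)) := integrableOn_const (by simp)
  have h1 : ‖∫ s in Set.Ioc (x - θ) (x + θ), G s‖ ≤ ∫ s in Set.Ioc (x - θ) (x + θ), (h s + ε) := by
    refine norm_integral_le_of_norm_le (hi.integrableOn.add hc) (Eventually.of_forall fun s => ?_)
    by_cases hs : R < |s|
    · exact (hGR s hs).trans (by linarith [hh0 s])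
    · have : h s = M := Set.indicator_of_mem (Set.mem_Icc.mpr (abs_le.mp (not_lt.mp hs))) _
      rw [this]
      linarith [hGM s]
  rw [integral_add hi.integrableOn hc] at h1
  have h2 : ∫ s in Set.Ioc (x - θ) (x + θ), h s ≤ 2 * R * M := by
    refine (setIntegral_le_integral hi (Eventually.of_forall hh0)).trans (le_of_eq ?_)
    rw [integral_indicator measurableSet_Icc, setIntegral_const, Measure.real, Real.volume_Icc,
      ENNReal.toReal_ofReal (by linarith), smul_eq_mul]
    ring
  have h3 : ∫ s in Set.Ioc (x - θ) (x + θ), ε = 2 * θ * ε := by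
    rw [setIntegral_const, Measure.real, Real.volume_Ioc,
      ENNReal.toReal_ofReal (by linarith), smul_eq_mul]
    ring
  linarith

/-- If a bounded measurable `ψ : ℝ → ℂ` vanishing on the negative reals has a Laplace
transform `ℒψ(s) = ∫_0^∞ ψ(t) e^{−st} dt` with `H¹` boundary behavior at `s = 0`
(vertical translates converge in `L¹` on a segment around `0` as `Re s → 0⁺`), then
`ψ` is almost convergent to `0`. -/
theorem laplace_H1_boundary_implies_almostConvergent_zero
    (ψ : ℝ → ℂ) (hmeas : Measurable ψ) (hbdd : ∃ C : ℝ, ∀ x, ‖ψ x‖ ≤ C)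
    (hneg : ∀ t : ℝ, t < 0 → ψ t = 0)
    (δ : ℝ) (hδ : 0 < δ) (F : ℝ → ℂ)
    (hF : IntegrableOn F (Set.Ioo (-δ) δ) volume)
    (hH1 : Tendsto (fun x : ℝ =>
        ∫ y in Set.Ioo (-δ) δ,
          ‖(∫ t in Set.Ioi (0 : ℝ),
              ψ t * Complex.exp (-((x + Complex.I * y) * t))) - F y‖)
      (nhdsWithin 0 (Set.Ioi 0)) (nhds 0)) :
    ∀ ε > (0 : ℝ), ∃ Θ : ℝ, ∀ θ : ℝ, Θ ≤ θ → ∀ x : ℝ,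
      ‖((1 / (2 * θ) : ℝ) : ℂ) * ∫ t in (x - θ)..(x + θ), ψ t‖ < ε := by
  intro ε hε
  obtain ⟨C, hC⟩ := hbdd
  have hC0 : 0 ≤ C := (norm_nonneg _).trans (hC 0)
  obtain ⟨φ, K, hφc, ⟨B, hB⟩, hφi, hφS, hK, hKc, hKi, hK1, hK0⟩ := exists_kernel δ hδ
  have hT := kernel_conv_tendsto ψ hmeas C hC hneg δ F hF hH1 φ K hφc B hB hφi hφS hK hKc hKi
  set c := ‖∫ t, K t‖ with hc
  have hcpos : 0 < c := norm_pos_iff.mpr hK0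
  have hε' : 0 < c * ε / 2 := by positivity
  have hev : ∀ᶠ x in cocompact ℝ, ‖∫ u, K u * ψ (x + u)‖ < c * ε / 2 := by
    have := (tendsto_zero_iff_norm_tendsto_zero.mp hT).eventually (gt_mem_nhds hε')
    exact this
  obtain ⟨R, hR0, hR⟩ : ∃ R : ℝ, 0 ≤ R ∧ ∀ x : ℝ, R < |x| → ‖∫ u, K u * ψ (x + u)‖ ≤ c * ε / 2 := by
    rw [← Metric.cobounded_eq_cocompact, (Metric.hasBasis_cobounded_compl_closedBall (0:ℝ)).eventually_iff] at hev
    obtain ⟨R, -, hR⟩ := hev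
    refine ⟨max R 0, le_max_right _ _, fun x hx => (hR ?_).le⟩
    simpa using (le_max_left _ _).trans_lt hx
  set M := C * ∫ t, ‖K t‖ with hMdef
  have hM0 : 0 ≤ M := mul_nonneg hC0 (integral_nonneg fun _ => norm_nonneg _)
  have hGM : ∀ x, ‖∫ u, K u * ψ (x + u)‖ ≤ M := by
    intro x
    rw [hMdef, ← integral_const_mul]
    refine norm_integral_le_of_norm_le (hKi.norm.const_mul _) (Eventually.of_forall fun u => ?_)
    rw [norm_mul, mul_comm]
    exact mul_le_mul_of_nonneg_right (hC _) (norm_nonneg _)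
  set A := 2 * C * (∫ t, |t| * ‖K t‖) + 2 * R * M with hA
  refine ⟨max 1 (A / (c * ε) + 1), fun θ hθ x => ?_⟩
  have hθ1 : 0 < θ := lt_of_lt_of_le one_pos ((le_max_left _ _).trans hθ)
  have hθ2 : A < θ * (c * ε) := by
    have : A / (c * ε) < θ := lt_of_lt_of_le (by linarith) ((le_max_right _ _).trans hθ)
    rwa [div_lt_iff₀ (by positivity)] at this
  have h1 := window_conv ψ hmeas C hC K hKc hKi hK1 x θ hθ1.le
  have h2 := window_bound (fun x => ∫ u, K u * ψ (x + u)) M R (c * ε / 2) hM0 hR0 hε'.le hGM hR x θ hθ1.le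
  rw [norm_mul, ← hc] at h1
  rw [norm_mul, Complex.norm_real, Real.norm_of_nonneg (by positivity), one_div_mul_eq_div,
    div_lt_iff₀ (by positivity)]
  have h3 : c * ‖∫ t in (x - θ)..(x + θ), ψ t‖ < c * (ε * (2 * θ)) := by linarith
  exact lt_of_mul_lt_mul_left h3 hcpos.le
end

section
/- Let ψ : [0, ∞) → ℂ be locally integrable and bounded from below, i.e., there is C > 0 with Re ψ(x) ≥ −C and Im ψ(x) ≥ −C for all x ≥ 0. Suppose the Laplace transform ℒψ(s) = ∫_0^∞ ψ(t) e^{−st} dt converges for every s with Re s > 0, and that ℒψ is analytic at s = 0: there exist r > 0 and an analytic function g on the open ball B(0, r) such that g(s) = ℒψ(s) whenever Re s > 0 and |s| < r. Then Ψ(x) := ∫_0^x ψ(t) dt is a bounded function on [0, ∞) which is one-sidedly almost convergent to g(0), i.e., lim_{θ→∞} (1/θ) ∫_x^{x+θ} Ψ(t) dt = g(0) uniformly in x ≥ 0. -/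
open MeasureTheory Filter

/-- Absolute convergence of the Laplace transform in the right half plane. -/
def LapConv (F : ℝ → ℂ) : Prop := ∀ s : ℂ, 0 < s.re →
      IntegrableOn (fun t : ℝ => F t * Complex.exp (-(s * t))) (Set.Ioi 0) volume

theorem sinc_int (v : ℝ) :
    ∫ w in (-1:ℝ)..1, Complex.exp (-(w * v * Complex.I)) = 2 * (Real.sinc v : ℂ) := by
  by_cases hv : v = 0
  · subst hv; simp; norm_num
  have h := integral_exp_mul_I_eq_sinc (-v)
  have h2 := intervalIntegral.integral_comp_mul_left (a := -1) (b := 1)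
    (fun t : ℝ => Complex.exp (t * Complex.I)) (c := -v) (by simpa using hv)
  have e : (fun w : ℝ => Complex.exp (-(w * v * Complex.I)))
      = fun w : ℝ => Complex.exp (((-v * w : ℝ) : ℂ) * Complex.I) := by
    ext w; congr 1; push_cast; ring
  rw [e, h2]
  simp only [mul_neg, mul_one, neg_neg] at h ⊢
  rw [show (v:ℝ) = -(-v) by ring] at *
  simp only [neg_neg] at *
  rw [h]
  have hv' : (v : ℂ) ≠ 0 := by exact_mod_cast hv
  rw [Real.sinc_neg]
  simp only [Complex.real_smul, Complex.ofReal_inv, Complex.ofReal_neg]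
  field_simp

theorem sinc_step_conv (F : ℝ → ℂ) (hF : LapConv F) (a x : ℝ) :
    LapConv (fun t => F t * (Real.sinc (a * (t - x)) : ℂ)) := by
  intro s hs
  have h := (hF s hs).bdd_mul (c := 1) (f := fun t : ℝ => (Real.sinc (a * (t - x)) : ℂ))
    (by
      apply Continuous.aestronglyMeasurable
      have := Real.continuous_sinc
      fun_prop) (by
      refine Eventually.of_forall fun t => ?_
      rw [Complex.norm_real]; exact Real.abs_sinc_le_one _)
  refine h.congr (Eventually.of_forall fun t => ?_)
  simp only; ring

theorem sinc_step (F : ℝ → ℂ) (hF : LapConv F) (a x : ℝ) (ha : 0 < a) (ρ b B : ℝ)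
    (hB : ∀ s : ℂ, 0 < s.re → s.re < ρ → |s.im| ≤ b + a →
      ‖∫ t in Set.Ioi (0 : ℝ), F t * Complex.exp (-(s * t))‖ ≤ B) :
    ∀ s : ℂ, 0 < s.re → s.re < ρ → |s.im| ≤ b →
      ‖∫ t in Set.Ioi (0 : ℝ), (F t * (Real.sinc (a * (t - x)) : ℂ)) *
        Complex.exp (-(s * t))‖ ≤ B := by
  intro s hs hs2 hb
  have key : ∫ w in (-1:ℝ)..1, Complex.exp (w * a * x * Complex.I) *
      (∫ t in Set.Ioi (0 : ℝ), F t * Complex.exp (-((s + w * a * Complex.I) * t)))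
      = 2 * ∫ t in Set.Ioi (0 : ℝ), (F t * (Real.sinc (a * (t - x)) : ℂ)) *
        Complex.exp (-(s * t)) := by
    rw [intervalIntegral.integral_of_le (by norm_num)]
    simp_rw [← integral_const_mul]
    rw [integral_integral_swap]
    · refine integral_congr_ae (Eventually.of_forall fun t => ?_)
      simp only
      have := sinc_int (a * (t - x))
      rw [intervalIntegral.integral_of_le (by norm_num)] at this
      calc _ = ∫ w in Set.Ioc (-1:ℝ) 1, (F t * Complex.exp (-(s * t))) *
              Complex.exp (-(w * (a * (t - x) : ℝ) * Complex.I)) := by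
            refine integral_congr_ae (Eventually.of_forall fun w => ?_)
            simp only
            rw [mul_left_comm, ← Complex.exp_add, mul_assoc (F t), ← Complex.exp_add]
            congr 2; push_cast; ring
        _ = _ := by rw [integral_const_mul, this]; ring
    · have h0 := (hF s hs).comp_snd (volume.restrict (Set.Ioc (-1:ℝ) 1))
      have h1 := h0.bdd_mul (c := 1)
        (f := fun p : ℝ × ℝ => Complex.exp (((-(p.1 * a * (p.2 - x)) : ℝ) : ℂ) * Complex.I))
        (by apply Continuous.aestronglyMeasurable; fun_prop)
        (Eventually.of_forall fun p => (Complex.norm_exp_ofReal_mul_I _).le)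
      refine h1.congr (Eventually.of_forall fun p => ?_)
      simp only [Function.uncurry]
      rw [mul_left_comm, mul_left_comm (Complex.exp _), ← Complex.exp_add, ← Complex.exp_add]
      congr 2; push_cast; ring
  have hle : ‖∫ w in (-1:ℝ)..1, Complex.exp (w * a * x * Complex.I) *
      (∫ t in Set.Ioi (0 : ℝ), F t * Complex.exp (-((s + w * a * Complex.I) * t)))‖
      ≤ B * |1 - (-1:ℝ)| := by
    refine intervalIntegral.norm_integral_le_of_norm_le_const fun w hw => ?_
    rw [Set.uIoc_of_le (by norm_num)] at hw
    rw [norm_mul]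
    have e : ‖Complex.exp (w * a * x * Complex.I)‖ = 1 := by
      have := Complex.norm_exp_ofReal_mul_I (w * a * x)
      simpa using this
    rw [e, one_mul]
    apply hB
    · simpa using hs
    · simpa using hs2
    · have : (s + w * a * Complex.I).im = s.im + w * a := by simp
      rw [this]
      refine (abs_add_le _ _).trans (add_le_add hb ?_)
      rw [abs_mul, abs_of_pos ha]
      have : |w| ≤ 1 := abs_le.2 ⟨hw.1.le, hw.2⟩
      nlinarith
  rw [key, norm_mul] at hle
  norm_num at hle
  linarith

theorem sinc_four (F : ℝ → ℂ) (hF : LapConv F) (a x : ℝ) (ha : 0 < a) (ρ B : ℝ)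
    (hB : ∀ s : ℂ, 0 < s.re → s.re < ρ → |s.im| ≤ 4 * a →
      ‖∫ t in Set.Ioi (0 : ℝ), F t * Complex.exp (-(s * t))‖ ≤ B) (σ : ℝ) (h0 : 0 < σ)
    (h1 : σ < ρ) :
    Integrable (fun t : ℝ => F t * ((Real.sinc (a * (t - x)) ^ 4 * Real.exp (-(σ * t)) : ℝ) : ℂ))
      (volume.restrict (Set.Ioi 0)) ∧ 
    ‖∫ t in Set.Ioi (0 : ℝ), F t * ((Real.sinc (a * (t - x)) ^ 4 * Real.exp (-(σ * t)) : ℝ) : ℂ)‖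
       ≤ B := by
  have c1 := sinc_step_conv F hF a x
  have c2 := sinc_step_conv _ c1 a x
  have c3 := sinc_step_conv _ c2 a x
  have c4 := sinc_step_conv _ c3 a x
  have b1 := sinc_step F hF a x ha ρ (3 * a) B (by convert hB using 5; ring)
  have b2 := sinc_step _ c1 a x ha ρ (2 * a) B (by convert b1 using 5; ring)
  have b3 := sinc_step _ c2 a x ha ρ (a) B (by convert b2 using 5; ring)
  have b4 := sinc_step _ c3 a x ha ρ 0 B (by convert b3 using 5; ring)
  have e : (fun t : ℝ => F t * ((Real.sinc (a * (t - x)) ^ 4 * Real.exp (-(σ * t)) : ℝ) : ℂ))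
    = fun t : ℝ => F t * (Real.sinc (a * (t - x)) : ℂ) * (Real.sinc (a * (t - x)) : ℂ)
      * (Real.sinc (a * (t - x)) : ℂ) * (Real.sinc (a * (t - x)) : ℂ) 
      * Complex.exp (-((σ : ℂ) * t)) := by
    ext t; push_cast; ring
  constructor
  · rw [e]; exact c4 σ (by simpa using h0)
  · rw [e]; exact b4 σ (by simpa using h0) (by simpa using h1) (by simp)

theorem lap_prim (ψ : ℝ → ℂ) (hF : LapConv ψ) :
    LapConv (fun t => ∫ u in (0:ℝ)..t, ψ u) ∧ ∀ s : ℂ, 0 < s.re →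
    ∫ t in Set.Ioi (0:ℝ), (∫ u in (0:ℝ)..t, ψ u) * Complex.exp (-(s * t)) =
     (∫ t in Set.Ioi (0:ℝ), ψ t * Complex.exp (-(s * t))) / s := by
  have main : ∀ s : ℂ, 0 < s.re → Integrable (fun p : ℝ × ℝ => 
      (Set.Ici p.1).indicator (fun t : ℝ => ψ p.1 * Complex.exp (-(s * t))) p.2)
      ((volume.restrict (Set.Ioi (0:ℝ))).prod (volume.restrict (Set.Ioi (0:ℝ)))) := by
    intro s hs
    have hs2 : 0 < (s/2).re := by simpa using hs
    have hE : IntegrableOn (fun t : ℝ => Complex.exp (-(s/2) * t)) (Set.Ioi 0) :=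
      integrableOn_exp_mul_complex_Ioi (by simpa using hs) 0
    have h0 := (hF (s/2) hs2).mul_prod hE
    have h1 := h0.bdd_mul (c := 1)
      (f := fun p : ℝ × ℝ => Set.indicator {q : ℝ × ℝ | q.1 ≤ q.2}
         (fun q : ℝ × ℝ => Complex.exp (-(s/2) * (q.2 - q.1))) p) 
      (by
        apply AEStronglyMeasurable.indicator
        · apply Continuous.aestronglyMeasurable; fun_prop
        · exact measurableSet_le measurable_fst measurable_snd)
      (by
        refine Eventually.of_forall fun p => ?_
        simp only [Set.indicator_apply, Set.mem_ofPred_eq]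
        split_ifs with h
        · rw [Complex.norm_exp]
          have : (-(s/2) * ((p.2:ℂ) - p.1)).re = -(s.re/2) * (p.2 - p.1) := by
            rw [← Complex.ofReal_sub, Complex.re_mul_ofReal]; simp
          rw [this, Real.exp_le_one_iff]
          nlinarith
        · simp)
    refine h1.congr (Eventually.of_forall fun p => ?_)
    simp only [Set.indicator_apply, Set.mem_ofPred_eq, Set.mem_Ici]
    split_ifs with h
    · rw [mul_left_comm, mul_assoc, ← Complex.exp_add, ← Complex.exp_add]
      congr 2; ring
    · simp
  have i1 : ∀ s : ℂ, ∀ t ∈ Set.Ioi (0:ℝ), ∫ u in Set.Ioi (0:ℝ), 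
      (Set.Ici u).indicator (fun t : ℝ => ψ u * Complex.exp (-(s * t))) t =
      (∫ u in (0:ℝ)..t, ψ u) * Complex.exp (-(s * t)) := by
    intro s t ht
    rw [intervalIntegral.integral_of_le (le_of_lt ht), ← integral_mul_const]
    rw [← Set.Ioi_inter_Iic, Set.inter_comm, ← Measure.restrict_restrict measurableSet_Iic,
      ← integral_indicator measurableSet_Iic]
    rfl
  constructor
  · intro s hs
    have := (main s hs).integral_prod_right
    refine (integrableOn_congr_fun ?_ measurableSet_Ioi).1 this
    intro t ht
    exact i1 s t ht
  · intro s hs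
    rw [← setIntegral_congr_fun measurableSet_Ioi (i1 s)]
    rw [← integral_integral_swap (main s hs), ← integral_div]
    refine setIntegral_congr_fun measurableSet_Ioi fun u hu => ?_
    rw [setIntegral_indicator measurableSet_Ici, Set.inter_eq_right.2 
      (Set.Ici_subset_Ioi.2 hu), integral_Ici_eq_integral_Ioi, integral_const_mul]
    have := integral_exp_mul_complex_Ioi (a := -s) (by simpa using hs) u
    simp only [neg_mul] at this
    rw [this]
    field_simp

theorem sinc_lower (u : ℝ) (h0 : 0 ≤ u) (h1 : u ≤ 1) : 1 / 16 ≤ Real.sinc u ^ 4 := by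
  have : 1 / 2 ≤ Real.sinc u := by
    rcases h0.eq_or_lt with h | h
    · rw [← h]; norm_num
    · rw [Real.sinc_of_ne_zero h.ne', le_div_iff₀ h]
      have := Real.sin_gt_sub_cube h
      nlinarith [mul_nonneg h0 (mul_nonneg h0 h0), mul_le_mul h1 h1 h0 (by norm_num)]
  calc (1:ℝ)/16 = (1/2)^4 := by norm_num
    _ ≤ _ := by gcongr

theorem sinc_decay (v : ℝ) : (1 + |v|) * Real.sinc v ^ 4 ≤ 8 * (1 + v ^ 2)⁻¹ := by
  have hs : v * Real.sinc v = Real.sin v := by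
    by_cases h : v = 0
    · simp [h]
    · rw [Real.sinc_of_ne_zero h]; field_simp
  have h1 : Real.sinc v ^ 2 ≤ 1 := by
    rw [sq_le_one_iff_abs_le_one]; exact Real.abs_sinc_le_one v
  have h2 : (v * Real.sinc v) ^ 2 ≤ 1 := by rw [hs]; exact Real.sin_sq_le_one v
  set q := Real.sinc v ^ 2 with hq
  have hq0 : 0 ≤ q := by positivity
  have h3 : (1 + v ^ 2) * q ≤ 2 := by rw [mul_pow] at h2; nlinarith
  have h4 : Real.sinc v ^ 4 = q * q := by rw [hq]; ring
  rw [← div_eq_mul_inv, le_div_iff₀ (by positivity), h4]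
  have h5 : 1 + |v| ≤ 2 * (1 + v ^ 2) := by nlinarith [sq_abs v, sq_nonneg (|v| - 1)]
  calc (1 + |v|) * (q * q) * (1 + v ^ 2) = ((1 + |v|) * q) * ((1 + v ^ 2) * q) := by ring
    _ ≤ (2 * (1 + v ^ 2) * q) * 2 := by gcongr
    _ ≤ 8 := by nlinarith

theorem W_int (a x : ℝ) (ha : 0 < a) :
    Integrable (fun t : ℝ => 8 * (1 + (a * (t - x)) ^ 2)⁻¹) ∧
    ∫ t : ℝ, 8 * (1 + (a * (t - x)) ^ 2)⁻¹ = 8 * Real.pi / a := by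
  constructor
  · exact ((integrable_inv_one_add_sq.comp_mul_left' ha.ne').comp_sub_right x).const_mul 8
  · rw [integral_const_mul, integral_sub_right_eq_self (fun t : ℝ => (1 + (a * t) ^ 2)⁻¹) x,
      Measure.integral_comp_mul_left (fun t : ℝ => (1 + t ^ 2)⁻¹) a, integral_univ_inv_one_add_sq,
      abs_of_pos (by positivity)]
    simp; field_simp

/-- The localizing kernel. -/
noncomputable def locKer (a x σ t : ℝ) : ℝ := Real.sinc (a * (t - x)) ^ 4 * Real.exp (-(σ * t))

theorem ker_cont (a x σ : ℝ) : Continuous (locKer a x σ) := by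
  unfold locKer
  have := Real.continuous_sinc
  fun_prop

theorem ker_nonneg (a x σ t : ℝ) : 0 ≤ locKer a x σ t := by
  unfold locKer; positivity

theorem ker_le (a x σ t : ℝ) (hσ : 0 < σ) (ht : 0 < t) :
    (1 + |a * (t - x)|) * locKer a x σ t ≤ 8 * (1 + (a * (t - x)) ^ 2)⁻¹ := by
  unfold locKer
  have h := sinc_decay (a * (t - x))
  have h2 : Real.exp (-(σ * t)) ≤ 1 := by
    rw [Real.exp_le_one_iff]; nlinarith
  calc _ = ((1 + |a * (t - x)|) * Real.sinc (a * (t - x)) ^ 4) * Real.exp (-(σ * t)) := by ring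
    _ ≤ ((1 + |a * (t - x)|) * Real.sinc (a * (t - x)) ^ 4) * 1 := by gcongr
    _ ≤ _ := by linarith

theorem ker_le' (a x σ t : ℝ) (hσ : 0 < σ) (ht : 0 < t) :
    locKer a x σ t ≤ 8 * (1 + (a * (t - x)) ^ 2)⁻¹ := by
  refine le_trans ?_ (ker_le a x σ t hσ ht)
  nlinarith [ker_nonneg a x σ t, abs_nonneg (a * (t - x)), mul_nonneg (abs_nonneg (a * (t - x))) (ker_nonneg a x σ t)]

theorem ker_int (a x σ : ℝ) (ha : 0 < a) (hσ : 0 < σ) :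
    IntegrableOn (locKer a x σ) (Set.Ioi 0) ∧ ∫ t in Set.Ioi (0:ℝ), locKer a x σ t ≤ 8 * Real.pi / a := by
  have hW := (W_int a x ha)
  have h : IntegrableOn (locKer a x σ) (Set.Ioi 0) := by
    refine Integrable.mono' hW.1.integrableOn (ker_cont a x σ).aestronglyMeasurable ?_
    filter_upwards [ae_restrict_mem measurableSet_Ioi] with t ht
    rw [Real.norm_of_nonneg (ker_nonneg _ _ _ _)]
    exact ker_le' a x σ t hσ ht
  refine ⟨h, ?_⟩
  rw [← hW.2]
  refine (setIntegral_mono_on h hW.1.integrableOn measurableSet_Ioi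
    fun t ht => ker_le' a x σ t hσ ht).trans ?_
  exact setIntegral_le_integral hW.1 (Eventually.of_forall fun t => by positivity)

theorem ker_low (a x ρ : ℝ) (ha : 0 < a) (hx : 0 ≤ x) (hρ : 0 < ρ) :
    ∃ σ, 0 < σ ∧ σ < ρ ∧ ∀ t, x ≤ t → t ≤ x + 1 / a → 1 / 32 ≤ locKer a x σ t := by
  have hp : 0 < x + 1 / a := by positivity
  refine ⟨min (ρ / 2) (1 / (2 * (x + 1 / a))), by positivity,
    (min_le_left _ _).trans_lt (by linarith), fun t h1 h2 => ?_⟩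
  set σ := min (ρ / 2) (1 / (2 * (x + 1 / a)))
  have hσ : 0 < σ := by positivity
  have hs : σ ≤ 1 / (2 * (x + 1 / a)) := min_le_right _ _
  have h3 : σ * t ≤ 1 / 2 := by
    calc σ * t ≤ (1 / (2 * (x + 1 / a))) * (x + 1 / a) := by gcongr; linarith
      _ = 1 / 2 := by field_simp
  have h4 : 1 / 2 ≤ Real.exp (-(σ * t)) := by
    have := Real.add_one_le_exp (-(σ * t)); linarith
  have h5 := sinc_lower (a * (t - x)) (mul_nonneg ha.le (by linarith)) (by
    calc a * (t - x) ≤ a * (1 / a) := by gcongr; linarith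
      _ = 1 := by field_simp)
  unfold locKer
  calc (1:ℝ) / 32 = 1 / 16 * (1 / 2) := by norm_num
    _ ≤ _ := by gcongr

/-- Local boundedness of integrals (Tauberian step 1). -/
theorem step_one (p : ℝ → ℝ) (C a ρ B : ℝ) (hC : 0 ≤ C) (ha : 0 < a) (hρ : 0 < ρ)
    (hp : ∀ t, 0 ≤ t → -C ≤ p t) (hloc : ∀ b : ℝ, IntegrableOn p (Set.Icc 0 b) volume)
    (hint : ∀ x σ, 0 < σ → σ < ρ → IntegrableOn (fun t => p t * locKer a x σ t) (Set.Ioi 0))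
    (hB : ∀ x σ, 0 < σ → σ < ρ → ∫ t in Set.Ioi (0:ℝ), p t * locKer a x σ t ≤ B) :
    ∃ A, 0 ≤ A ∧ ∀ x y, 0 ≤ x → x ≤ y → |∫ t in x..y, p t| ≤ A * (1 + a * (y - x)) := by
  have II : ∀ x y, 0 ≤ x → 0 ≤ y → IntervalIntegrable p volume x y := by
    intro x y hx hy
    rw [intervalIntegrable_iff]
    refine (hloc (max x y)).mono_set ?_
    intro t ht
    rw [Set.uIoc, Set.mem_Ioc] at ht
    exact ⟨(le_min hx hy).trans ht.1.le, ht.2⟩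
  have II' : ∀ x y, 0 ≤ x → 0 ≤ y → IntervalIntegrable (fun t => p t + C) volume x y :=
    fun x y hx hy => (II x y hx hy).add intervalIntegrable_const
  set D := 32 * (B + C * (8 * Real.pi / a)) with hD
  have h1 : ∀ x, 0 ≤ x → ∫ t in x..(x + 1 / a), (p t + C) ≤ D := by
    intro x hx
    obtain ⟨σ, h0, hlt, hlow⟩ := ker_low a x ρ ha hx hρ
    have hle : x ≤ x + 1 / a := by simp [ha.le]
    have k := ker_int a x σ ha h0
    have e : (fun t => (p t + C) * locKer a x σ t) = fun t => p t * locKer a x σ t + C * locKer a x σ t := by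
      ext t; ring
    have hi : IntegrableOn (fun t => (p t + C) * locKer a x σ t) (Set.Ioi 0) := by
      rw [e]; exact (hint x σ h0 hlt).add (k.1.const_mul C)
    have hsub : Set.Ioc x (x + 1 / a) ⊆ Set.Ioi 0 := fun t ht => lt_of_le_of_lt hx ht.1
    have a1 : ∫ t in Set.Ioi (0:ℝ), (p t + C) * locKer a x σ t ≤ B + C * (8 * Real.pi / a) := by
      rw [e, integral_add (hint x σ h0 hlt) (k.1.const_mul C), integral_const_mul]
      have := hB x σ h0 hlt
      have := mul_le_mul_of_nonneg_left k.2 hC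
      linarith
    have a2 : ∫ t in Set.Ioc x (x + 1 / a), (p t + C) * locKer a x σ t ≤
        ∫ t in Set.Ioi (0:ℝ), (p t + C) * locKer a x σ t := by
      refine setIntegral_mono_set hi ?_ hsub.eventuallyLE
      filter_upwards [ae_restrict_mem measurableSet_Ioi] with t ht
      have := hp t (le_of_lt ht)
      exact mul_nonneg (by linarith) (ker_nonneg _ _ _ _)
    have a3 : ∫ t in Set.Ioc x (x + 1 / a), (p t + C) * (1 / 32) ≤
        ∫ t in Set.Ioc x (x + 1 / a), (p t + C) * locKer a x σ t := by
      refine setIntegral_mono_on ?_ (hi.mono_set hsub) measurableSet_Ioc fun t ht => ?_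
      · have := (II' x (x + 1 / a) hx (hx.trans hle)).1
        exact this.mul_const _
      · have := hp t (hx.trans ht.1.le)
        exact mul_le_mul_of_nonneg_left (hlow t ht.1.le ht.2) (by linarith)
    rw [integral_mul_const, ← intervalIntegral.integral_of_le hle] at a3
    linarith
  have h2 : ∀ n : ℕ, ∀ x, 0 ≤ x → ∫ t in x..(x + n / a), (p t + C) ≤ n * D := by
    intro n x hx
    induction n with
    | zero => simp
    | succ n ih =>
      have hn : 0 ≤ (n : ℝ) / a := by positivity
      have h1a : 0 ≤ 1 / a := by positivity
      have e : x + ((n + 1 : ℕ) : ℝ) / a = x + n / a + 1 / a := by push_cast; ring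
      rw [e, ← intervalIntegral.integral_add_adjacent_intervals
        (II' x (x + n / a) hx (by linarith)) (II' _ _ (by linarith) (by linarith))]
      have := h1 (x + n / a) (by linarith)
      push_cast
      linarith
  have hD0 : 0 ≤ D := by
    refine le_trans ?_ (h1 0 le_rfl)
    refine intervalIntegral.integral_nonneg (by simp [ha.le]) fun t ht => ?_
    have := hp t ht.1; linarith
  refine ⟨D + C / a, by positivity, fun x y hx hxy => ?_⟩
  have hy := hx.trans hxy
  have hyx : 0 ≤ y - x := by linarith
  have e1 : ∫ t in x..y, (p t + C) = (∫ t in x..y, p t) + C * (y - x) := by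
    rw [intervalIntegral.integral_add (II x y hx hy) intervalIntegrable_const]
    simp [mul_comm]
  have e2 : 0 ≤ ∫ t in x..y, (p t + C) := by
    refine intervalIntegral.integral_nonneg hxy fun t ht => ?_
    have := hp t (hx.trans ht.1); linarith
  have e3 : ∫ t in x..y, (p t + C) ≤ D * (1 + a * (y - x)) := by
    set n := ⌈a * (y - x)⌉₊
    have hn1 : a * (y - x) ≤ n := Nat.le_ceil _
    have hn2 : (n : ℝ) < a * (y - x) + 1 := Nat.ceil_lt_add_one (by positivity)
    have hyn : y ≤ x + n / a := by
      have : y - x ≤ n / a := by rw [le_div_iff₀ ha]; linarith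
      linarith
    have := h2 n x hx
    rw [← intervalIntegral.integral_add_adjacent_intervals
        (II' x y hx hy) (II' _ _ hy (hy.trans hyn))] at this
    have h0 : 0 ≤ ∫ t in y..(x + n / a), (p t + C) := by
      refine intervalIntegral.integral_nonneg hyn fun t ht => ?_
      have := hp t (hy.trans ht.1); linarith
    nlinarith
  have e4 : C / a * (1 + a * (y - x)) = C / a + C * (y - x) := by field_simp
  have e5 : 0 ≤ C / a := by positivity
  have e6 : 0 ≤ D * (1 + a * (y - x)) := by positivity
  have e7 : 0 ≤ C * (y - x) := by positivity
  rw [add_mul, e4, abs_le]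
  constructor <;> linarith

/-- Tauberian step 2. -/
theorem step_two (Φ : ℝ → ℂ) (a ρ A B : ℝ) (ha : 0 < a) (hρ : 0 < ρ) (hA : 0 ≤ A)
    (hΦ : ∀ x y, 0 ≤ x → 0 ≤ y → ‖Φ y - Φ x‖ ≤ A * (1 + |a * (y - x)|))
    (hint : ∀ x σ, 0 < σ → σ < ρ →
      IntegrableOn (fun t => Φ t * (locKer a x σ t : ℂ)) (Set.Ioi 0))
    (hB : ∀ x σ, 0 < σ → σ < ρ → ‖∫ t in Set.Ioi (0:ℝ), Φ t * (locKer a x σ t : ℂ)‖ ≤ B) :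
    ∀ x, 0 ≤ x → ‖Φ x‖ ≤ 32 * a * (B + A * (8 * Real.pi / a)) := by
  intro x hx
  obtain ⟨σ, h0, hlt, hlow⟩ := ker_low a x ρ ha hx hρ
  have k := ker_int a x σ ha h0
  have hle : x ≤ x + 1 / a := by simp [ha.le]
  have hsub : Set.Ioc x (x + 1 / a) ⊆ Set.Ioi 0 := fun t ht => lt_of_le_of_lt hx ht.1
  set E := ∫ t in Set.Ioi (0:ℝ), locKer a x σ t with hE
  have hE1 : 1 / a * (1 / 32) ≤ E := by
    have a2 : ∫ t in Set.Ioc x (x + 1 / a), locKer a x σ t ≤ E := 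
      setIntegral_mono_set k.1 (Eventually.of_forall fun t => ker_nonneg _ _ _ _) hsub.eventuallyLE
    have a3 : ∫ t in Set.Ioc x (x + 1 / a), (1 / 32 : ℝ) ≤
        ∫ t in Set.Ioc x (x + 1 / a), locKer a x σ t := by
      refine setIntegral_mono_on (by simp) (k.1.mono_set hsub) measurableSet_Ioc fun t ht => 
        hlow t ht.1.le ht.2
    rw [← intervalIntegral.integral_of_le hle, intervalIntegral.integral_const] at a3
    simp only [smul_eq_mul, add_sub_cancel_left] at a3
    linarith
  have hk : IntegrableOn (fun t => Φ x * (locKer a x σ t : ℂ)) (Set.Ioi 0) := k.1.ofReal.const_mul _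
  have e : Φ x * (E : ℂ) = (∫ t in Set.Ioi (0:ℝ), Φ t * (locKer a x σ t : ℂ)) -
      ∫ t in Set.Ioi (0:ℝ), (Φ t - Φ x) * (locKer a x σ t : ℂ) := by
    simp_rw [sub_mul]
    rw [integral_sub (hint x σ h0 hlt) hk, integral_const_mul, integral_complex_ofReal]
    simp [hE]
  have hW := W_int a x ha
  have hd : ‖∫ t in Set.Ioi (0:ℝ), (Φ t - Φ x) * (locKer a x σ t : ℂ)‖ ≤ A * (8 * Real.pi / a) := by
    rw [← hW.2, ← integral_const_mul]
    refine (norm_integral_le_of_norm_le (hW.1.const_mul A).integrableOn ?_).trans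
      (setIntegral_le_integral (hW.1.const_mul A) (Eventually.of_forall fun t => by positivity))
    filter_upwards [ae_restrict_mem measurableSet_Ioi] with t ht
    rw [norm_mul, Complex.norm_real, Real.norm_of_nonneg (ker_nonneg _ _ _ _)]
    calc _ ≤ A * (1 + |a * (t - x)|) * locKer a x σ t := 
          mul_le_mul_of_nonneg_right (hΦ x t hx (le_of_lt ht)) (ker_nonneg _ _ _ _)
      _ = A * ((1 + |a * (t - x)|) * locKer a x σ t) := by ring
      _ ≤ _ := mul_le_mul_of_nonneg_left (ker_le a x σ t h0 ht) hA
  have hn : ‖Φ x‖ * E ≤ B + A * (8 * Real.pi / a) := by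
    have hE0 : 0 ≤ E := le_trans (by positivity) hE1
    calc ‖Φ x‖ * E = ‖Φ x * (E : ℂ)‖ := by 
          rw [norm_mul, Complex.norm_real, Real.norm_of_nonneg hE0]
      _ ≤ _ := by rw [e]; exact (norm_sub_le _ _).trans (add_le_add (hB x σ h0 hlt) hd)
  have := mul_le_mul_of_nonneg_left hE1 (norm_nonneg (Φ x))
  calc ‖Φ x‖ = 32 * a * (‖Φ x‖ * (1 / a * (1 / 32))) := by field_simp
    _ ≤ _ := by gcongr; linarith

theorem lap_Phi (ψ : ℝ → ℂ) (hconv : LapConv ψ) (r : ℝ) (g : ℂ → ℂ)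
    (hagree : ∀ s : ℂ, 0 < s.re → ‖s‖ < r →
      g s = ∫ t in Set.Ioi (0 : ℝ), ψ t * Complex.exp (-(s * t))) :
    LapConv (fun t => (∫ u in (0:ℝ)..t, ψ u) - g 0) ∧ ∀ s : ℂ, 0 < s.re → ‖s‖ < r →
      dslope g 0 s = ∫ t in Set.Ioi (0 : ℝ), ((∫ u in (0:ℝ)..t, ψ u) - g 0) *
        Complex.exp (-(s * t)) := by
  obtain ⟨h1, h2⟩ := lap_prim ψ hconv
  have hE : ∀ s : ℂ, 0 < s.re → IntegrableOn (fun t : ℝ => Complex.exp (-(s * t))) (Set.Ioi 0) := by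
    intro s hs
    have := integrableOn_exp_mul_complex_Ioi (a := -s) (by simpa using hs) 0
    simpa only [neg_mul] using this
  constructor
  · intro s hs
    simp only [sub_mul]
    exact (h1 s hs).sub ((hE s hs).const_mul (g 0))
  · intro s hs hsr
    have hs0 : s ≠ 0 := by rintro rfl; simp at hs
    simp only [sub_mul]
    rw [integral_sub (h1 s hs) ((hE s hs).const_mul (g 0)), h2 s hs, integral_const_mul,
      ← hagree s hs hsr]
    have := integral_exp_mul_complex_Ioi (a := -s) (by simpa using hs) 0
    simp only [neg_mul] at this
    rw [this, dslope_of_ne _ hs0, slope_def_field]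
    simp
    field_simp

theorem bounded_prim
    (ψ : ℝ → ℂ)
    (hloc : ∀ b : ℝ, IntegrableOn ψ (Set.Icc 0 b) volume)
    (hbb : ∃ C : ℝ, 0 < C ∧ ∀ x : ℝ, 0 ≤ x → -C ≤ (ψ x).re ∧ -C ≤ (ψ x).im)
    (hconv : LapConv ψ)
    (r : ℝ) (hr : 0 < r) (g : ℂ → ℂ)
    (hg : DifferentiableOn ℂ g (Metric.ball (0 : ℂ) r))
    (hagree : ∀ s : ℂ, 0 < s.re → ‖s‖ < r →
      g s = ∫ t in Set.Ioi (0 : ℝ), ψ t * Complex.exp (-(s * t))) :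
    ∃ M : ℝ, ∀ x : ℝ, 0 ≤ x → ‖(∫ t in (0 : ℝ)..x, ψ t) - g 0‖ ≤ M := by
  obtain ⟨C, hC, hbb⟩ := hbb
  have bdd : ∀ f : ℂ → ℂ, DifferentiableOn ℂ f (Metric.ball (0 : ℂ) r) →
      ∃ B, ∀ s : ℂ, 0 < s.re → s.re < r / 4 → |s.im| ≤ 4 * (r / 16) → ‖s‖ < r ∧ ‖f s‖ ≤ B := by
    intro f hf
    have hsub : Metric.closedBall (0:ℂ) (r / 2) ⊆ Metric.ball 0 r :=
      Metric.closedBall_subset_ball (by linarith)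
    obtain ⟨B, hB⟩ := (isCompact_closedBall (0:ℂ) (r/2)).exists_bound_of_continuousOn
      (hf.continuousOn.mono hsub)
    refine ⟨B, fun s h0 h1 h2 => ?_⟩
    have hs : ‖s‖ ≤ r / 2 := by
      refine (Complex.norm_le_abs_re_add_abs_im s).trans ?_
      rw [abs_of_pos h0]; linarith
    exact ⟨by linarith, hB s (by simpa using hs)⟩
  have hG : DifferentiableOn ℂ (dslope g 0) (Metric.ball (0 : ℂ) r) :=
    (Complex.differentiableOn_dslope (Metric.ball_mem_nhds 0 hr)).2 hg
  obtain ⟨c1, c2⟩ := lap_Phi ψ hconv r g hagree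
  obtain ⟨B1, hB1⟩ := bdd g hg
  obtain ⟨B2, hB2⟩ := bdd _ hG
  set a := r / 16 with ha'
  have ha : 0 < a := by positivity
  have hρ : 0 < r / 4 := by positivity
  have s1 : ∀ x σ, 0 < σ → σ < r / 4 → 
      IntegrableOn (fun t => ψ t * (locKer a x σ t : ℂ)) (Set.Ioi 0) ∧ 
      ‖∫ t in Set.Ioi (0:ℝ), ψ t * (locKer a x σ t : ℂ)‖ ≤ B1 := fun x σ h0 h1 =>
    sinc_four ψ hconv a x ha (r / 4) B1 (fun s p q w => by
      rw [← hagree s p (hB1 s p q w).1]; exact (hB1 s p q w).2) σ h0 h1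
  have s2 : ∀ x σ, 0 < σ → σ < r / 4 → 
      IntegrableOn (fun t => ((∫ u in (0:ℝ)..t, ψ u) - g 0) * (locKer a x σ t : ℂ)) (Set.Ioi 0) ∧ 
      ‖∫ t in Set.Ioi (0:ℝ), ((∫ u in (0:ℝ)..t, ψ u) - g 0) * (locKer a x σ t : ℂ)‖ ≤ B2 :=
    fun x σ h0 h1 =>
    sinc_four _ c1 a x ha (r / 4) B2 (fun s p q w => by
      rw [← c2 s p (hB2 s p q w).1]; exact (hB2 s p q w).2) σ h0 h1
  obtain ⟨A1, hA1, h1⟩ := step_one (fun t => (ψ t).re) C a (r / 4) B1 hC.le ha hρ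
    (fun t ht => (hbb t ht).1) (fun b => (hloc b).re)
    (fun x σ p q => by simpa using! (s1 x σ p q).1.re)
    (fun x σ p q => by
      have := Complex.reCLM.integral_comp_comm (s1 x σ p q).1
      simp only [Complex.reCLM_apply, Complex.re_mul_ofReal] at this
      rw [this]
      exact (Complex.re_le_norm _).trans (s1 x σ p q).2)
  obtain ⟨A2, hA2, h2⟩ := step_one (fun t => (ψ t).im) C a (r / 4) B1 hC.le ha hρ
    (fun t ht => (hbb t ht).2) (fun b => (hloc b).im)
    (fun x σ p q => by simpa using! (s1 x σ p q).1.im)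
    (fun x σ p q => by
      have := Complex.imCLM.integral_comp_comm (s1 x σ p q).1
      simp only [Complex.imCLM_apply, Complex.im_mul_ofReal] at this
      rw [this]
      exact ((le_abs_self _).trans (Complex.abs_im_le_norm _)).trans (s1 x σ p q).2)
  have II : ∀ x y, 0 ≤ x → 0 ≤ y → IntervalIntegrable ψ volume x y := by
    intro x y hx hy
    rw [intervalIntegrable_iff]
    refine (hloc (max x y)).mono_set ?_
    intro t ht
    rw [Set.uIoc, Set.mem_Ioc] at ht
    exact ⟨(le_min hx hy).trans ht.1.le, ht.2⟩
  have h3 : ∀ x y, 0 ≤ x → x ≤ y → ‖∫ t in x..y, ψ t‖ ≤ (A1 + A2) * (1 + a * (y - x)) := by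
    intro x y hx hxy
    have i := II x y hx (hx.trans hxy)
    have e1 := Complex.reCLM.intervalIntegral_comp_comm i
    have e2 := Complex.imCLM.intervalIntegral_comp_comm i
    simp only [Complex.reCLM_apply, Complex.imCLM_apply] at e1 e2
    refine (Complex.norm_le_abs_re_add_abs_im _).trans ?_
    rw [← e1, ← e2, add_mul]
    exact add_le_add (h1 x y hx hxy) (h2 x y hx hxy)
  have h4 : ∀ x y, 0 ≤ x → 0 ≤ y → ((∫ u in (0:ℝ)..y, ψ u) - g 0) - ((∫ u in (0:ℝ)..x, ψ u) - g 0)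
      = ∫ t in x..y, ψ t := by
    intro x y hx hy
    rw [sub_sub_sub_cancel_right, intervalIntegral.integral_interval_sub_left
      (II 0 y le_rfl hy) (II 0 x le_rfl hx)]
  refine ⟨_, step_two (fun t => (∫ u in (0:ℝ)..t, ψ u) - g 0) a (r / 4) (A1 + A2) B2 ha hρ
    (by positivity) ?_ (fun x σ p q => (s2 x σ p q).1) (fun x σ p q => (s2 x σ p q).2)⟩
  intro x y hx hy
  rw [h4 x y hx hy, abs_mul, abs_of_pos ha]
  rcases le_total x y with h | h
  · rw [abs_of_nonneg (by linarith)]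
    exact h3 x y hx h
  · rw [intervalIntegral.integral_symm, norm_neg, abs_sub_comm, abs_of_nonneg (by linarith)]
    exact h3 y x hy h


/-- Continuous analogue of the Fatou–Riesz theorem: if `ψ` is locally integrable on
`[0,∞)`, bounded from below, its Laplace transform converges on the open right
half-plane and is analytic at `s = 0` (i.e. extends analytically to a ball around
`0`), then `Ψ(x) = ∫_0^x ψ` is bounded and one-sidedly almost convergent to the value
of the extension at `0`. -/
theorem laplace_analytic_implies_primitive_oneSided_almostConvergent
    (ψ : ℝ → ℂ)
    (hloc : ∀ b : ℝ, IntegrableOn ψ (Set.Icc 0 b) volume)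
    (hbb : ∃ C : ℝ, 0 < C ∧ ∀ x : ℝ, 0 ≤ x → -C ≤ (ψ x).re ∧ -C ≤ (ψ x).im)
    (hconv : ∀ s : ℂ, 0 < s.re →
      IntegrableOn (fun t : ℝ => ψ t * Complex.exp (-(s * t))) (Set.Ioi 0) volume)
    (r : ℝ) (hr : 0 < r) (g : ℂ → ℂ)
    (hg : DifferentiableOn ℂ g (Metric.ball (0 : ℂ) r))
    (hagree : ∀ s : ℂ, 0 < s.re → ‖s‖ < r →
      g s = ∫ t in Set.Ioi (0 : ℝ), ψ t * Complex.exp (-(s * t))) :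
    (∃ M : ℝ, ∀ x : ℝ, 0 ≤ x → ‖∫ t in (0 : ℝ)..x, ψ t‖ ≤ M) ∧
    (∀ ε > (0 : ℝ), ∃ Θ : ℝ, ∀ θ : ℝ, Θ ≤ θ → ∀ x : ℝ, 0 ≤ x →
      ‖((1 / θ : ℝ) : ℂ) *
          (∫ t in x..(x + θ), ∫ u in (0 : ℝ)..t, ψ u) - g 0‖ < ε) := by
  have II : ∀ x y, 0 ≤ x → 0 ≤ y → IntervalIntegrable ψ volume x y := by
    intro x y hx hy
    rw [intervalIntegrable_iff]
    refine (hloc (max x y)).mono_set ?_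
    intro t ht
    rw [Set.uIoc, Set.mem_Ioc] at ht
    exact ⟨(le_min hx hy).trans ht.1.le, ht.2⟩
  obtain ⟨M, hM⟩ := bounded_prim ψ hloc hbb hconv r hr g hg hagree
  have hM0 : 0 ≤ M := (norm_nonneg _).trans (hM 0 le_rfl)
  obtain ⟨c1, c2⟩ := lap_Phi ψ hconv r g hagree
  have hG : DifferentiableOn ℂ (dslope g 0) (Metric.ball (0 : ℂ) r) :=
    (Complex.differentiableOn_dslope (Metric.ball_mem_nhds 0 hr)).2 hg
  have hcont : ∀ b : ℝ, 0 ≤ b → ContinuousOn (fun t => ∫ u in (0:ℝ)..t, ψ u) (Set.Icc 0 b) := by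
    intro b hb
    have := intervalIntegral.continuousOn_primitive_interval (a := 0) (b := b) (f := ψ) (μ := volume)
      (by rw [Set.uIcc_of_le hb]; exact hloc b)
    rwa [Set.uIcc_of_le hb] at this
  have hlocΦ : ∀ b : ℝ, IntegrableOn (fun t => (∫ u in (0:ℝ)..t, ψ u) - g 0) (Set.Icc 0 b) volume := by
    intro b
    rcases lt_or_ge b 0 with hb | hb
    · rw [Set.Icc_eq_empty (by linarith)]; simp
    · exact ((hcont b hb).sub continuousOn_const).integrableOn_Icc
  obtain ⟨N, hN⟩ := bounded_prim (fun t => (∫ u in (0:ℝ)..t, ψ u) - g 0) hlocΦ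
    ⟨M + 1, by linarith, fun x hx => by
      have h := hM x hx
      have h1 := Complex.abs_re_le_norm ((∫ u in (0:ℝ)..x, ψ u) - g 0)
      have h2 := Complex.abs_im_le_norm ((∫ u in (0:ℝ)..x, ψ u) - g 0)
      have h3 := (abs_le.1 (h1.trans h)).1
      have h4 := (abs_le.1 (h2.trans h)).1
      constructor <;> linarith⟩ c1 r hr _ hG c2
  have hN0 : 0 ≤ N := (norm_nonneg _).trans (hN 0 le_rfl)
  have IΦ : ∀ x y, 0 ≤ x → 0 ≤ y →
      IntervalIntegrable (fun t => (∫ u in (0:ℝ)..t, ψ u) - g 0) volume x y := by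
    intro x y hx hy
    rw [intervalIntegrable_iff]
    refine (hlocΦ (max x y)).mono_set ?_
    intro t ht
    rw [Set.uIoc, Set.mem_Ioc] at ht
    exact ⟨(le_min hx hy).trans ht.1.le, ht.2⟩
  refine ⟨⟨M + ‖g 0‖, fun x hx => ?_⟩, fun ε hε => ⟨2 * N / ε + 1, fun θ hθ x hx => ?_⟩⟩
  · have := norm_add_le ((∫ u in (0:ℝ)..x, ψ u) - g 0) (g 0)
    rw [sub_add_cancel] at this
    linarith [hM x hx]
  · have hq : 0 ≤ 2 * N / ε := by positivity
    have hθ0 : 0 < θ := by linarith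
    have hy : 0 ≤ x + θ := by linarith
    have e0 : ∫ t in x..(x + θ), (∫ u in (0 : ℝ)..t, ψ u)
        = (∫ t in x..(x + θ), ((∫ u in (0 : ℝ)..t, ψ u) - g 0)) + θ * g 0 := by
      have := intervalIntegral.integral_add (IΦ x (x + θ) hx hy)
        (intervalIntegrable_const (c := g 0))
      simp only [sub_add_cancel] at this
      rw [this]; simp
    have e1 := intervalIntegral.integral_interval_sub_left
      (IΦ 0 (x + θ) le_rfl hy) (IΦ 0 x le_rfl hx)
    have hb : ‖∫ t in x..(x + θ), ((∫ u in (0 : ℝ)..t, ψ u) - g 0)‖ ≤ 2 * N := by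
      rw [← e1, ← sub_sub_sub_cancel_right _ _ (dslope g 0 0)]
      refine (norm_sub_le _ _).trans ?_
      linarith [hN x hx, hN (x + θ) hy]
    have hθc : (θ : ℂ) ≠ 0 := by exact_mod_cast hθ0.ne'
    have e2 : ((1 / θ : ℝ) : ℂ) * (∫ t in x..(x + θ), ∫ u in (0 : ℝ)..t, ψ u) - g 0
        = ((1 / θ : ℝ) : ℂ) * ∫ t in x..(x + θ), ((∫ u in (0 : ℝ)..t, ψ u) - g 0) := by
      rw [e0]; push_cast; field_simp; ring
    rw [e2, norm_mul, Complex.norm_real, Real.norm_of_nonneg (by positivity)]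
    calc 1 / θ * _ ≤ 1 / θ * (2 * N) := by gcongr
      _ < ε := by
        rw [one_div, inv_mul_lt_iff₀ hθ0]
        have : 2 * N / ε < θ := by linarith
        rwa [div_lt_iff₀ hε] at this
end
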